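/- arXiv:2008.11382 — 6 statements merged into one kernel-verified Lean document; each statement's English description precedes it below -/
import Mathlib

section
/- Let h : ℝ → ℝ be continuously differentiable with |h'(r)| ≤ k* λ^{−α} for all r, and let y : ℝ × ℝ^d → ℝ be C¹ with bounded spatial gradient ∇_x y such that ∫_{ℝ×ℝ^d} |∇_x y|² dt dx < ∞. Then there is a constant C depending only on d, k*, and sup φ such that |∇_x H_λ[h,y](t,x)| ≤ C λ^{−α−(d+1)/2} ( ∫_{ℝ×ℝ^d} |∇_x y|² dt dx )^{1/2} for every (t,x); i.e., the spatial gradient of H_λ[h,y] is uniformly bounded in terms of the L² norm of ∇_x y. -/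
open MeasureTheory Set

/-- The averaged coefficient
`H_λ[h,y](t,x) = (1/λ) ∫_t^{t+λ} ∫_{ℝ^d} h(y(s, x − λξ)) φ(ξ) dξ ds`. -/
noncomputable def Hlam (d : ℕ) (lam : ℝ) (φ : EuclideanSpace ℝ (Fin d) → ℝ)
    (h : ℝ → ℝ) (y : ℝ × EuclideanSpace ℝ (Fin d) → ℝ)
    (t : ℝ) (x : EuclideanSpace ℝ (Fin d)) : ℝ :=
  (1 / lam) * ∫ s in t..(t + lam), (∫ ξ, h (y (s, x - lam • ξ)) * φ ξ)


lemma aux_cs {X : Type*} [MeasurableSpace X] (μ : Measure X) [IsFiniteMeasure μ] (f : X → ℝ)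
    (hf : Integrable f μ) (hf2 : Integrable (fun p => f p ^ 2) μ) :
    (∫ p, f p ∂μ) ^ 2 ≤ μ.real univ * ∫ p, f p ^ 2 ∂μ := by
  set V := μ.real univ with hV
  set m := ∫ p, f p ∂μ with hm
  have h0 : 0 ≤ ∫ p, (V * f p - m) ^ 2 ∂μ := integral_nonneg fun p => sq_nonneg _
  have h1 : ∫ p, (V * f p - m) ^ 2 ∂μ = V ^ 2 * (∫ p, f p ^ 2 ∂μ) - 2 * V * m * m + V * m ^ 2 := by
    have : (fun p => (V * f p - m) ^ 2) =
        fun p => (V ^ 2 * f p ^ 2 - 2 * V * m * f p) + m ^ 2 := by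
      funext p; ring
    have hsub : Integrable (fun p => V ^ 2 * f p ^ 2 - 2 * V * m * f p) μ :=
      (hf2.const_mul _).sub (hf.const_mul _)
    rw [this, integral_add hsub (integrable_const _),
      integral_sub (hf2.const_mul _) (hf.const_mul _), integral_const_mul, integral_const_mul,
      integral_const, smul_eq_mul]
  have hVnn : 0 ≤ V := measureReal_nonneg
  rcases hVnn.eq_or_lt with h | h
  · have hμ : μ = 0 := by
      rw [← Measure.measure_univ_eq_zero]
      have := h.symm
      rw [hV, measureReal_def, ENNReal.toReal_eq_zero_iff] at this
      exact this.resolve_right (measure_ne_top _ _)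
    have : m = 0 := by rw [hm, hμ]; simp
    rw [this, ← h]; simp
  · rw [h1] at h0
    have : 0 ≤ V * (V * (∫ p, f p ^ 2 ∂μ) - m ^ 2) := by nlinarith
    have := nonneg_of_mul_nonneg_right this h
    linarith

lemma aux_map (d : ℕ) (lam : ℝ) (hl : 0 < lam) (x : EuclideanSpace ℝ (Fin d)) :
    Measure.map (fun p : ℝ × EuclideanSpace ℝ (Fin d) => (p.1, x - lam • p.2)) volume
      = ENNReal.ofReal ((lam ^ d)⁻¹) • (volume : Measure (ℝ × EuclideanSpace ℝ (Fin d))) := by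
  have h1 : Measure.map (fun ξ : EuclideanSpace ℝ (Fin d) => x - lam • ξ) volume
      = ENNReal.ofReal ((lam ^ d)⁻¹) • volume := by
    have : (fun ξ : EuclideanSpace ℝ (Fin d) => x - lam • ξ) = (fun w => x - w) ∘ (lam • ·) := rfl
    rw [this, ← Measure.map_map (by fun_prop) (by fun_prop), Measure.map_addHaar_smul _ hl.ne',
      Measure.map_smul, (Measure.measurePreserving_sub_left volume x).map_eq]
    simp only [finrank_euclideanSpace, Fintype.card_fin]
    rw [abs_of_pos (by positivity)]
  have h2 : (fun p : ℝ × EuclideanSpace ℝ (Fin d) => (p.1, x - lam • p.2))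
      = Prod.map id (fun ξ => x - lam • ξ) := rfl
  have : SFinite (Measure.map (fun ξ : EuclideanSpace ℝ (Fin d) => x - lam • ξ) volume) := by
    infer_instance
  rw [h2, Measure.volume_eq_prod, ← Measure.map_prod_map _ _ measurable_id (by fun_prop), h1,
    Measure.map_id, Measure.prod_smul_right]

lemma aux_fderiv (d : ℕ) (y : ℝ × EuclideanSpace ℝ (Fin d) → ℝ) (hy : ContDiff ℝ 1 y)
    (s : ℝ) (w : EuclideanSpace ℝ (Fin d)) :
    HasFDerivAt (fun z => y (s, z))
      ((fderiv ℝ y (s, w)).comp (ContinuousLinearMap.inr ℝ ℝ (EuclideanSpace ℝ (Fin d)))) w := by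
  have h1 : HasFDerivAt y (fderiv ℝ y (s, w)) (s, w) :=
    (hy.differentiable (by simp) (s, w)).hasFDerivAt
  exact h1.comp w (hasFDerivAt_prodMk_right s w)

lemma aux_cont (d : ℕ) (y : ℝ × EuclideanSpace ℝ (Fin d) → ℝ) (hy : ContDiff ℝ 1 y) :
    Continuous (fun p : ℝ × EuclideanSpace ℝ (Fin d) => fderiv ℝ (fun z => y (p.1, z)) p.2) := by
  have : (fun p : ℝ × EuclideanSpace ℝ (Fin d) => fderiv ℝ (fun z => y (p.1, z)) p.2) =
      fun p => (fderiv ℝ y p).comp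
        (ContinuousLinearMap.inr ℝ ℝ (EuclideanSpace ℝ (Fin d))) := by
    funext p
    exact (aux_fderiv d y hy p.1 p.2).fderiv
  rw [this]
  exact (hy.continuous_fderiv (by simp)).clm_comp continuous_const

lemma aux_Hlam (d : ℕ) (lam : ℝ) (hl : 0 < lam) (φ : EuclideanSpace ℝ (Fin d) → ℝ)
    (hφc : Continuous φ) (hφsupp : ∀ ξ, 1 < ‖ξ‖ → φ ξ = 0)
    (h : ℝ → ℝ) (hh : Continuous h) (y : ℝ × EuclideanSpace ℝ (Fin d) → ℝ) (hy : Continuous y)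
    (t : ℝ) (x : EuclideanSpace ℝ (Fin d)) :
    Integrable (fun p : ℝ × EuclideanSpace ℝ (Fin d) => h (y (p.1, x - lam • p.2)) * φ p.2)
      (volume.restrict (Ioc t (t + lam) ×ˢ Metric.closedBall 0 1)) ∧
    Hlam d lam φ h y t x = (1 / lam) * ∫ p in (Ioc t (t + lam) ×ˢ Metric.closedBall 0 1),
      h (y (p.1, x - lam • p.2)) * φ p.2 := by
  have hi : IntegrableOn (fun p : ℝ × EuclideanSpace ℝ (Fin d) =>
      h (y (p.1, x - lam • p.2)) * φ p.2)
      (Ioc t (t + lam) ×ˢ Metric.closedBall 0 1) volume := by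
    have hc : Continuous (fun p : ℝ × EuclideanSpace ℝ (Fin d) =>
      h (y (p.1, x - lam • p.2)) * φ p.2) := by fun_prop
    have hK : IsCompact (Icc t (t + lam) ×ˢ
        Metric.closedBall (0 : EuclideanSpace ℝ (Fin d)) 1) :=
      isCompact_Icc.prod (isCompact_closedBall 0 1)
    exact (hc.continuousOn.integrableOn_compact hK).mono_set
      (prod_mono_left Ioc_subset_Icc_self)
  refine ⟨hi, ?_⟩
  unfold Hlam
  rw [intervalIntegral.integral_of_le (by linarith), Measure.volume_eq_prod,
    setIntegral_prod _ hi]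
  congr 1
  refine integral_congr_ae (Filter.Eventually.of_forall fun s => ?_)
  refine (setIntegral_eq_integral_of_forall_compl_eq_zero fun ξ hξ => ?_).symm
  have : φ ξ = 0 := hφsupp ξ (by simpa using hξ)
  simp [this]

theorem gradient_uniform_bound
    (d : ℕ) (hd : 1 ≤ d) (kstar : ℝ) (hk : 0 < kstar)
    (φ : EuclideanSpace ℝ (Fin d) → ℝ)
    (hφc : Continuous φ) (hφ0 : ∀ ξ, 0 ≤ φ ξ)
    (hφsupp : ∀ ξ, 1 < ‖ξ‖ → φ ξ = 0) (hφint : ∫ ξ, φ ξ = 1) :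
    ∃ C : ℝ, 0 < C ∧
      ∀ (lam α : ℝ), lam ∈ Set.Ioo (0:ℝ) 1 → α ∈ Set.Ioo (0:ℝ) 1 →
      ∀ hfun : ℝ → ℝ, ContDiff ℝ 1 hfun →
        (∀ r, |deriv hfun r| ≤ kstar * lam ^ (-α)) →
      ∀ y : ℝ × EuclideanSpace ℝ (Fin d) → ℝ, ContDiff ℝ 1 y →
        (∃ M : ℝ, ∀ (s : ℝ) (ξ : EuclideanSpace ℝ (Fin d)),
          ‖fderiv ℝ (fun z => y (s, z)) ξ‖ ≤ M) →
      Integrable (fun p : ℝ × EuclideanSpace ℝ (Fin d) =>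
        ‖fderiv ℝ (fun z => y (p.1, z)) p.2‖ ^ 2) →
      ∀ (t : ℝ) (x : EuclideanSpace ℝ (Fin d)),
        ‖fderiv ℝ (fun z => Hlam d lam φ hfun y t z) x‖ ≤
          C * lam ^ (-α - ((d : ℝ) + 1) / 2) *
            Real.sqrt (∫ p : ℝ × EuclideanSpace ℝ (Fin d),
              ‖fderiv ℝ (fun z => y (p.1, z)) p.2‖ ^ 2) := by
  have hcs : HasCompactSupport φ := by
    refine HasCompactSupport.intro (isCompact_closedBall (0 : EuclideanSpace ℝ (Fin d)) 1) ?_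
    intro ξ hξ
    exact hφsupp ξ (by simpa using hξ)
  obtain ⟨S0, hS0⟩ := hcs.exists_bound_of_continuous hφc
  set S : ℝ := |S0| + 1 with hS
  have hSpos : 0 < S := by positivity
  have hφS : ∀ ξ, |φ ξ| ≤ S := fun ξ => by
    have := hS0 ξ
    rw [Real.norm_eq_abs] at this
    linarith [le_abs_self S0]
  set V : ℝ := (volume : Measure (EuclideanSpace ℝ (Fin d))).real (Metric.closedBall 0 1) with hV
  have hVnn : 0 ≤ V := measureReal_nonneg
  refine ⟨S * kstar * (Real.sqrt V + 1), by positivity, ?_⟩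
  rintro lam α ⟨hl, hl1⟩ hα h hh hh' y hy ⟨M, hM⟩ hint t x
  set D : ℝ × EuclideanSpace ℝ (Fin d) → (EuclideanSpace ℝ (Fin d) →L[ℝ] ℝ) :=
    fun p => fderiv ℝ (fun z => y (p.1, z)) p.2 with hD
  have hDc : Continuous D := aux_cont d y hy
  set A : Set (ℝ × EuclideanSpace ℝ (Fin d)) := Ioc t (t + lam) ×ˢ Metric.closedBall 0 1 with hA
  set μ : Measure (ℝ × EuclideanSpace ℝ (Fin d)) := volume.restrict A with hμ
  set K : ℝ := kstar * lam ^ (-α) with hK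
  have hKpos : 0 < K := by positivity
  have hM0 : 0 ≤ M := (norm_nonneg _).trans (hM 0 0)
  have hvol : volume A = ENNReal.ofReal lam *
      volume (Metric.closedBall (0 : EuclideanSpace ℝ (Fin d)) 1) := by
    rw [hA, Measure.volume_eq_prod, Measure.prod_prod, Real.volume_Ioc]
    simp
  have hAfin : volume A < ⊤ := by
    rw [hvol]
    exact ENNReal.mul_lt_top ENNReal.ofReal_lt_top measure_closedBall_lt_top
  have : IsFiniteMeasure μ := ⟨by rw [hμ, Measure.restrict_apply_univ]; exact hAfin⟩
  have hμV : μ.real univ = lam * V := by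
    rw [hμ, measureReal_restrict_apply_univ, measureReal_def, hvol, ENNReal.toReal_mul,
      ENNReal.toReal_ofReal hl.le, hV, measureReal_def]
  set F' : EuclideanSpace ℝ (Fin d) → ℝ × EuclideanSpace ℝ (Fin d) →
      (EuclideanSpace ℝ (Fin d) →L[ℝ] ℝ) :=
    fun z p => (φ p.2 * deriv h (y (p.1, z - lam • p.2))) • D (p.1, z - lam • p.2) with hF'
  have hyc := hy.continuous
  have hhc := hh.continuous
  have hhdc : Continuous (deriv h) := hh.continuous_deriv (by simp)
  have hF'c : ∀ z, Continuous (F' z) := fun z => by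
    simp only [hF']
    fun_prop
  have hF'b : ∀ z p, ‖F' z p‖ ≤ S * K * ‖D (p.1, z - lam • p.2)‖ := fun z p => by
    simp only [hF']
    rw [norm_smul, norm_mul, Real.norm_eq_abs, Real.norm_eq_abs]
    gcongr
    · exact hφS _
    · exact hh' _
  have hDM : ∀ p, ‖D p‖ ≤ M := fun p => hM p.1 p.2
  have hder : HasFDerivAt (fun z => ∫ p, h (y (p.1, z - lam • p.2)) * φ p.2 ∂μ)
      (∫ p, F' x p ∂μ) x := by
    refine hasFDerivAt_integral_of_dominated_of_fderiv_le (bound := fun _ => S * K * M)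
      (s := univ) Filter.univ_mem ?_ ?_ ?_ ?_ (integrable_const _) ?_
    · refine Filter.Eventually.of_forall fun z => ?_
      exact (aux_Hlam d lam hl φ hφc hφsupp h hhc y hyc t z).1.aestronglyMeasurable
    · exact (aux_Hlam d lam hl φ hφc hφsupp h hhc y hyc t x).1
    · exact (hF'c x).aestronglyMeasurable
    · refine Filter.Eventually.of_forall fun p z _ => (hF'b z p).trans ?_
      gcongr
      exact hDM _
    · refine Filter.Eventually.of_forall fun p z _ => ?_
      have h1 : HasFDerivAt (fun w => y (p.1, w)) (D (p.1, z - lam • p.2)) (z - lam • p.2) :=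
        (aux_fderiv d y hy p.1 (z - lam • p.2)).differentiableAt.hasFDerivAt
      have h2 : HasFDerivAt (fun w => y (p.1, w - lam • p.2)) (D (p.1, z - lam • p.2)) z := by
        have := h1.comp z ((hasFDerivAt_id z).sub_const (lam • p.2))
        rw [ContinuousLinearMap.comp_id] at this
        exact this
      have h3 : HasDerivAt h (deriv h (y (p.1, z - lam • p.2))) (y (p.1, z - lam • p.2)) :=
        (hh.differentiable (by simp) _).hasDerivAt
      have h4 := (h3.comp_hasFDerivAt z h2).mul_const (φ p.2)
      simpa [hF', smul_smul] using h4
  have hfd : fderiv ℝ (fun z => Hlam d lam φ h y t z) x = (1 / lam) • ∫ p, F' x p ∂μ := by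
    have : (fun z => Hlam d lam φ h y t z) =
        fun z => (1 / lam) * ∫ p, h (y (p.1, z - lam • p.2)) * φ p.2 ∂μ := by
      funext z
      exact (aux_Hlam d lam hl φ hφc hφsupp h hhc y hyc t z).2
    rw [this]
    exact (hder.const_mul (1 / lam)).fderiv
  -- change of variables
  set T : ℝ × EuclideanSpace ℝ (Fin d) → ℝ × EuclideanSpace ℝ (Fin d) :=
    fun p => (p.1, x - lam • p.2) with hT
  have hTc : Continuous T := by simp only [hT]; fun_prop
  have hG : Continuous (fun p => ‖D p‖ ^ 2) := by fun_prop
  have hmap := aux_map d lam hl x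
  have hIT : Integrable (fun p => ‖D (T p)‖ ^ 2) volume := by
    have h1 : Integrable (fun p => ‖D p‖ ^ 2) (Measure.map T volume) := by
      rw [hmap]
      exact hint.smul_measure ENNReal.ofReal_ne_top
    exact (integrable_map_measure hG.aestronglyMeasurable hTc.aemeasurable).1 h1
  have hITe : ∫ p, ‖D (T p)‖ ^ 2 = (lam ^ d)⁻¹ * ∫ p, ‖D p‖ ^ 2 := by
    rw [← integral_map (f := fun p => ‖D p‖ ^ 2) hTc.aemeasurable hG.aestronglyMeasurable, hmap,
      integral_smul_measure, ENNReal.toReal_ofReal (by positivity), smul_eq_mul]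
  set I : ℝ := ∫ p, ‖D p‖ ^ 2 with hI
  have hInn : 0 ≤ I := integral_nonneg fun p => sq_nonneg _
  have hDT : Continuous (fun p => ‖D (T p)‖) := by fun_prop
  have hDTi : Integrable (fun p => ‖D (T p)‖) μ :=
    Integrable.of_bound hDT.aestronglyMeasurable M
      (Filter.Eventually.of_forall fun p => by simpa using hDM (T p))
  have hcs2 := aux_cs μ (fun p => ‖D (T p)‖) hDTi hIT.restrict
  have hle : ∫ p, ‖D (T p)‖ ^ 2 ∂μ ≤ (lam ^ d)⁻¹ * I := by
    rw [← hITe]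
    exact setIntegral_le_integral hIT (Filter.Eventually.of_forall fun p => sq_nonneg _)
  have hmain : ∫ p, ‖D (T p)‖ ∂μ ≤ Real.sqrt (lam * V * ((lam ^ d)⁻¹ * I)) := by
    apply Real.le_sqrt_of_sq_le
    refine hcs2.trans ?_
    rw [hμV]
    gcongr
  have hnorm : ‖∫ p, F' x p ∂μ‖ ≤ S * K * ∫ p, ‖D (T p)‖ ∂μ := by
    rw [← integral_const_mul]
    exact norm_integral_le_of_norm_le (hDTi.const_mul _)
      (Filter.Eventually.of_forall fun p => hF'b x p)
  have hpow : lam ^ (-α - ((d : ℝ) + 1) / 2) =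
      lam ^ (-α) * ((1 / lam) * Real.sqrt (lam * (lam ^ d)⁻¹)) := by
    have e1 : lam * (lam ^ d)⁻¹ = lam ^ (1 - (d : ℝ)) := by
      rw [Real.rpow_sub hl, Real.rpow_one, Real.rpow_natCast, div_eq_mul_inv]
    have e2 : 1 / lam = lam ^ (-1 : ℝ) := by
      rw [Real.rpow_neg_one, one_div]
    rw [e1, e2, Real.sqrt_eq_rpow, ← Real.rpow_mul hl.le, ← Real.rpow_add hl, ← Real.rpow_add hl]
    congr 1
    ring
  have hsq : Real.sqrt (lam * V * ((lam ^ d)⁻¹ * I)) =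
      Real.sqrt (lam * (lam ^ d)⁻¹) * Real.sqrt V * Real.sqrt I := by
    rw [← Real.sqrt_mul (by positivity), ← Real.sqrt_mul (by positivity)]
    congr 1
    ring
  rw [hfd, norm_smul, Real.norm_eq_abs, abs_of_pos (by positivity), hpow]
  calc 1 / lam * ‖∫ p, F' x p ∂μ‖
      ≤ 1 / lam * (S * K * (Real.sqrt (lam * (lam ^ d)⁻¹) * Real.sqrt V * Real.sqrt I)) := by
        rw [← hsq]
        gcongr
        exact hnorm.trans (by gcongr)
    _ ≤ 1 / lam * (S * K * (Real.sqrt (lam * (lam ^ d)⁻¹) * (Real.sqrt V + 1) * Real.sqrt I)) := by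
        gcongr
        linarith
    _ = _ := by
        rw [hK]
        ring
end

section
/- Let (h_λ)_{λ ∈ (0,1)} be any family of functions as in the context (one for each λ, with the same k1, k2, ρ, α), and define β' : ℝ → ℝ by β'(r) = k1 for r < 0, β'(r) = 0 for 0 ≤ r ≤ ρ, and β'(r) = k2 for r > ρ. Then for every measurable function y : ℝ × ℝ^d → ℝ and every measurable set Q ⊂ ℝ × ℝ^d of finite Lebesgue measure, ∫_Q |H_λ[h_λ, y](t,x) − β'(y(t,x))| dt dx → 0 as λ → 0⁺. -/
open MeasureTheory Set Filter

/-- The limit enthalpy derivative: `β'(r) = k1` for `r < 0`, `0` on `[0, ρ]`, `k2` for `r > ρ`. -/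
noncomputable def betaPrime (k1 k2 ρ : ℝ) (r : ℝ) : ℝ :=
  if r < 0 then k1 else if r ≤ ρ then 0 else k2

namespace HlamAux

open scoped Topology ENNReal NNReal

abbrev E (d : ℕ) := EuclideanSpace ℝ (Fin d)

noncomputable def V (d : ℕ) : Measure (ℝ × E d) := (volume : Measure ℝ).prod volume

instance (d : ℕ) : (V d).IsAddHaarMeasure := by unfold V; infer_instance

noncomputable def nu {d : ℕ} (φ : E d → ℝ) : Measure (E d) :=
  volume.withDensity (fun ξ => ((φ ξ).toNNReal : ℝ≥0∞))

noncomputable def mu {d : ℕ} (φ : E d → ℝ) : Measure (ℝ × E d) :=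
  ((volume : Measure ℝ).restrict (Ioc 0 1)).prod (nu φ)

def G {d : ℕ} (lam : ℝ) (p w : ℝ × E d) : ℝ × E d := (p.1 + lam * w.1, p.2 - lam • w.2)

lemma G_meas {d : ℕ} (lam : ℝ) : Measurable (fun q : (ℝ × E d) × (ℝ × E d) => G lam q.1 q.2) := by
  unfold G
  fun_prop

lemma G_meas' {d : ℕ} (lam : ℝ) (p : ℝ × E d) : Measurable (G lam p) :=
  (G_meas lam).comp (measurable_const.prodMk measurable_id)

lemma nu_prob {d : ℕ} (φ : E d → ℝ) (hφ0 : ∀ ξ, 0 ≤ φ ξ) (hφint : ∫ ξ, φ ξ = 1) :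
    IsProbabilityMeasure (nu φ) := by
  have hi : Integrable φ := by
    by_contra h
    rw [integral_undef h] at hφint
    exact zero_ne_one hφint
  constructor
  rw [nu, withDensity_apply _ MeasurableSet.univ, Measure.restrict_univ]
  have := ofReal_integral_eq_lintegral_ofReal hi (Eventually.of_forall hφ0)
  rw [hφint, ENNReal.ofReal_one] at this
  exact this.symm

lemma mu_prob {d : ℕ} (φ : E d → ℝ) (hφ0 : ∀ ξ, 0 ≤ φ ξ) (hφint : ∫ ξ, φ ξ = 1) :
    IsProbabilityMeasure (mu φ) := by
  have := nu_prob φ hφ0 hφint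
  have : IsProbabilityMeasure ((volume : Measure ℝ).restrict (Ioc 0 1)) := by
    constructor; simp
  unfold mu
  infer_instance

lemma mu_le {d : ℕ} (φ : E d → ℝ) (hφc : Continuous φ)
    (hφsupp : ∀ ξ, 1 < ‖ξ‖ → φ ξ = 0) :
    ∃ M : ℝ≥0, ∀ S, mu φ S ≤ M * V d (S ∩ Metric.closedBall 0 1) := by
  have hs : HasCompactSupport φ := by
    refine HasCompactSupport.of_support_subset_isCompact (isCompact_closedBall (0 : E d) 1) ?_
    intro ξ hξ
    by_contra h
    apply hξ
    apply hφsupp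
    simpa using h
  obtain ⟨C, hC⟩ := hφc.bounded_above_of_compact_support hs
  refine ⟨C.toNNReal, ?_⟩
  have h1 : nu φ ≤ (C.toNNReal : ℝ≥0∞) • (volume : Measure (E d)).restrict (Metric.closedBall 0 1) := by
    rw [← withDensity_const, ← withDensity_indicator Metric.isClosed_closedBall.measurableSet]
    apply withDensity_mono
    refine Eventually.of_forall fun ξ => ?_
    by_cases h : ξ ∈ Metric.closedBall (0 : E d) 1
    · simp only [Set.indicator_of_mem h]
      norm_cast
      exact Real.toNNReal_le_toNNReal ((le_abs_self _).trans (hC ξ))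
    · have : φ ξ = 0 := hφsupp ξ (by simpa using h)
      simp [this]
  have h2 : (volume : Measure ℝ).restrict (Ioc 0 1) ≤ volume.restrict (Metric.closedBall 0 1) := by
    apply Measure.restrict_mono _ le_rfl
    intro t ht
    simp [abs_le]
    constructor <;> linarith [ht.1, ht.2]
  intro S
  have h3 := Measure.prod_mono h2 h1
  have h4 := h3 S
  rw [Measure.prod_smul_right, Measure.prod_restrict, closedBall_prod_same] at h4
  refine h4.trans ?_
  rw [Measure.smul_apply, Measure.restrict_apply' Metric.isClosed_closedBall.measurableSet, smul_eq_mul]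
  rfl

lemma G_vol {d : ℕ} {lam : ℝ} (hl : 0 < lam) (p : ℝ × E d) (T : Set (ℝ × E d)) (hT : MeasurableSet T) :
    V d (G lam p ⁻¹' T) = ENNReal.ofReal ((lam ^ Module.finrank ℝ (ℝ × E d))⁻¹) * V d T := by
  have hR : MeasurePreserving (Prod.map id Neg.neg : ℝ × E d → ℝ × E d) (V d) (V d) :=
    (MeasurePreserving.id (volume : Measure ℝ)).prod (Measure.measurePreserving_neg (volume : Measure (E d)))
  have e : G lam p ⁻¹' T = Prod.map id Neg.neg ⁻¹' ((fun x => lam • x) ⁻¹' ((fun h => p + h) ⁻¹' T)) := by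
    ext w
    simp [G, sub_eq_add_neg, Prod.add_def]
  have hm : MeasurableSet ((fun x => lam • x) ⁻¹' ((fun h => p + h) ⁻¹' T)) :=
    (measurable_const_smul lam) ((measurable_const_add p) hT)
  rw [e, hR.measure_preimage hm.nullMeasurableSet, Measure.addHaar_preimage_smul _ hl.ne', measure_preimage_add,
    abs_of_nonneg (by positivity)]

lemma mu_G {d : ℕ} (φ : E d → ℝ) {M : ℝ≥0}
    (hM : ∀ S, mu φ S ≤ M * V d (S ∩ Metric.closedBall 0 1))
    {lam : ℝ} (hl : 0 < lam) (p : ℝ × E d) (S : Set (ℝ × E d)) (hS : MeasurableSet S) :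
    mu φ (G lam p ⁻¹' S) ≤ M * V d (Metric.ball 0 1) *
      (V d (S ∩ Metric.closedBall p lam) / V d (Metric.closedBall p lam)) := by
  have hsub : G lam p ⁻¹' S ∩ Metric.closedBall 0 1 ⊆ G lam p ⁻¹' (S ∩ Metric.closedBall p lam) := by
    rintro w ⟨h1, h2⟩
    refine ⟨h1, ?_⟩
    rw [mem_closedBall_zero_iff, Prod.norm_def, max_le_iff] at h2
    rw [Metric.mem_closedBall, Prod.dist_eq, max_le_iff]
    constructor
    · simp only [G, dist_self_add_left, norm_mul, Real.norm_of_nonneg hl.le]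
      nlinarith [h2.1]
    · simp only [G, dist_eq_norm, sub_sub_cancel_left, norm_neg, norm_smul, Real.norm_of_nonneg hl.le]
      nlinarith [h2.2]
  refine (hM _).trans ?_
  rw [mul_assoc]
  gcongr
  refine (measure_mono hsub).trans ?_
  rw [G_vol hl p _ (hS.inter Metric.isClosed_closedBall.measurableSet),
    Measure.addHaar_closedBall _ _ hl.le]
  set B := V d (Metric.ball 0 1) with hB
  have hB0 : B ≠ 0 := (Metric.measure_ball_pos _ _ one_pos).ne'
  have hBt : B ≠ ⊤ := measure_ball_lt_top.ne
  have hn : 0 < lam ^ Module.finrank ℝ (ℝ × E d) := by positivity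
  rw [ENNReal.ofReal_inv_of_pos hn, ENNReal.div_eq_inv_mul, ENNReal.mul_inv (Or.inr hBt) (Or.inr hB0)]
  rw [← mul_assoc, mul_comm B, mul_assoc _ B⁻¹ B, ENNReal.inv_mul_cancel hB0 hBt, mul_one]

lemma core {d : ℕ} (φ : E d → ℝ) [IsProbabilityMeasure (mu φ)] {M : ℝ≥0}
    (hM : ∀ S, mu φ S ≤ M * V d (S ∩ Metric.closedBall 0 1))
    (A : Set (ℝ × E d)) (hA : MeasurableSet A) (p : ℝ × E d)
    (hden : Tendsto (fun r => V d (Aᶜ ∩ Metric.closedBall p r) / V d (Metric.closedBall p r))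
      (𝓝[>] 0) (𝓝 0))
    (F : ℝ → ℝ × E d → ℝ) (b K : ℝ) (ε : ℝ → ℝ) (hε : Tendsto ε (𝓝[>] 0) (𝓝 0))
    (hK : 0 ≤ K)
    (hF : ∀ᶠ lam in 𝓝[>] (0:ℝ), Measurable (F lam) ∧ 0 ≤ ε lam ∧ (∀ q, |F lam q - b| ≤ K) ∧
      ∀ q ∈ A, |F lam q - b| ≤ ε lam) :
    Tendsto (fun lam => ∫ w, F lam (G lam p w) ∂(mu φ)) (𝓝[>] 0) (𝓝 b) := by
  have hc : (M * V d (Metric.ball 0 1) : ℝ≥0∞) ≠ ⊤ :=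
    ENNReal.mul_ne_top ENNReal.coe_ne_top measure_ball_lt_top.ne
  have h1 : Tendsto (fun lam => mu φ (G lam p ⁻¹' Aᶜ)) (𝓝[>] 0) (𝓝 0) := by
    have h2 := ENNReal.Tendsto.const_mul hden (Or.inr hc)
    rw [mul_zero] at h2
    refine tendsto_of_tendsto_of_tendsto_of_le_of_le' tendsto_const_nhds h2
      (Eventually.of_forall fun _ => zero_le) ?_
    filter_upwards [self_mem_nhdsWithin] with lam hl
    exact mu_G φ hM hl p _ hA.compl
  have h3 : Tendsto (fun lam => ε lam + K * (mu φ).real (G lam p ⁻¹' Aᶜ)) (𝓝[>] 0) (𝓝 0) := by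
    have := (ENNReal.tendsto_toReal ENNReal.zero_ne_top).comp h1
    have h4 := hε.add (this.const_mul K)
    rw [ENNReal.toReal_zero, mul_zero, add_zero] at h4
    exact h4
  rw [tendsto_iff_dist_tendsto_zero]
  refine squeeze_zero' (Eventually.of_forall fun _ => dist_nonneg) ?_ h3
  filter_upwards [hF] with lam ⟨hm, he, hb, hbA⟩
  have hmG : Measurable (fun w => F lam (G lam p w)) := hm.comp (G_meas' lam p)
  have hSm : MeasurableSet (G lam p ⁻¹' Aᶜ) := (G_meas' lam p) hA.compl
  have hint : Integrable (fun w => F lam (G lam p w)) (mu φ) := by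
    refine Integrable.of_bound hmG.aestronglyMeasurable (K + |b|) (Eventually.of_forall fun w => ?_)
    have := hb (G lam p w)
    have h5 := abs_add_le (F lam (G lam p w) - b) b
    rw [sub_add_cancel] at h5
    rw [Real.norm_eq_abs]; linarith
  have e1 : (∫ w, F lam (G lam p w) ∂(mu φ)) - b = ∫ w, (F lam (G lam p w) - b) ∂(mu φ) := by
    rw [integral_sub hint (integrable_const _)]; simp
  rw [Real.dist_eq, e1]
  refine abs_integral_le_integral_abs.trans ?_
  have hi2 : Integrable ((G lam p ⁻¹' Aᶜ).indicator (fun _ => K)) (mu φ) :=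
    (integrable_const K).indicator hSm
  calc ∫ w, |F lam (G lam p w) - b| ∂(mu φ)
      ≤ ∫ w, (ε lam + (G lam p ⁻¹' Aᶜ).indicator (fun _ => K) w) ∂(mu φ) := by
        refine integral_mono (hint.sub (integrable_const _)).abs ((integrable_const _).add hi2) ?_
        intro w
        by_cases hw : G lam p w ∈ A
        · have : w ∉ G lam p ⁻¹' Aᶜ := fun h => h hw
          simp only [Set.indicator_of_notMem this, add_zero]
          exact hbA _ hw
        · have : w ∈ G lam p ⁻¹' Aᶜ := hw
          simp only [Set.indicator_of_mem this]
          linarith [hb (G lam p w)]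
    _ = _ := by
        rw [integral_add (integrable_const _) hi2, integral_indicator_const _ hSm]
        simp [mul_comm]

lemma Hlam_eq {d : ℕ} (φ : E d → ℝ) (hφc : Continuous φ) (hφ0 : ∀ ξ, 0 ≤ φ ξ)
    (hφint : ∫ ξ, φ ξ = 1) (h : ℝ → ℝ) (hh : Measurable h) (K : ℝ) (hK : ∀ r, |h r| ≤ K)
    (y : ℝ × E d → ℝ) (hy : Measurable y) {lam : ℝ} (hl : 0 < lam) (p : ℝ × E d) :
    Hlam d lam φ h y p.1 p.2 = ∫ w, h (y (G lam p w)) ∂(mu φ) := by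
  have := nu_prob φ hφ0 hφint
  have := mu_prob φ hφ0 hφint
  have hint : Integrable (fun w => h (y (G lam p w))) (mu φ) :=
    Integrable.of_bound ((hh.comp hy).comp (G_meas' lam p)).aestronglyMeasurable K
      (Eventually.of_forall fun w => hK _)
  unfold mu at hint ⊢
  rw [integral_prod _ hint]
  have h1 := intervalIntegral.integral_comp_add_mul (a := 0) (b := 1)
    (fun s => ∫ ξ, h (y (s, p.2 - lam • ξ)) * φ ξ) hl.ne' p.1
  rw [mul_zero, add_zero, mul_one, smul_eq_mul] at h1
  rw [Hlam, one_div, ← h1, intervalIntegral.integral_of_le zero_le_one]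
  congr 1
  ext s
  rw [nu, integral_withDensity_eq_integral_smul hφc.measurable.real_toNNReal]
  congr 1
  ext ξ
  rw [NNReal.smul_def, Real.coe_toNNReal _ (hφ0 ξ), smul_eq_mul, mul_comm]
  rfl

lemma h_facts {a k1 k2 ρ kstar : ℝ} (ha : 0 < a) (hk1 : 0 < k1) (hk2 : 0 < k2) (hρ : 0 < ρ)
    (hkstar : kstar = max k1 k2) (h g : ℝ → ℝ)
    (h1 : ∀ r, r < -a → h r = k1) (h2 : ∀ r, ρ + a < r → h r = k2)
    (h3 : ∀ r ∈ Set.Icc (-a) (ρ + a), h r = g r)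
    (h4 : ContinuousOn g (Set.Icc (-a) (ρ + a)))
    (h5 : ∀ r ∈ Set.Icc (-a) (ρ + a), a ≤ g r ∧ g r ≤ kstar) :
    Measurable h ∧ ∀ r, 0 ≤ h r ∧ h r ≤ kstar := by
  have e : h = fun r => if r < -a then k1 else if ρ + a < r then k2 else
      g (max (-a) (min (ρ + a) r)) := by
    ext r
    split_ifs with c1 c2
    · exact h1 r c1
    · exact h2 r c2
    · rw [min_eq_right (not_lt.1 c2), max_eq_right (not_lt.1 c1)]
      exact h3 r ⟨not_lt.1 c1, not_lt.1 c2⟩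
  constructor
  · rw [e]
    refine Measurable.ite measurableSet_Iio measurable_const
      (Measurable.ite measurableSet_Ioi measurable_const ?_)
    apply Continuous.measurable
    refine h4.comp_continuous (by fun_prop) ?_
    intro r
    exact ⟨le_max_left _ _, max_le (by linarith) (min_le_left _ _)⟩
  · intro r
    have hm1 : k1 ≤ kstar := hkstar ▸ le_max_left _ _
    have hm2 : k2 ≤ kstar := hkstar ▸ le_max_right _ _
    by_cases c1 : r < -a
    · rw [h1 r c1]; exact ⟨hk1.le, hm1⟩
    by_cases c2 : ρ + a < r
    · rw [h2 r c2]; exact ⟨hk2.le, hm2⟩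
    have c : r ∈ Set.Icc (-a) (ρ + a) := ⟨not_lt.1 c1, not_lt.1 c2⟩
    rw [h3 r c]
    exact ⟨ha.le.trans (h5 r c).1, (h5 r c).2⟩

lemma density {d : ℕ} (A : Set (ℝ × E d)) (hA : MeasurableSet A) :
    ∀ᵐ p ∂(V d), p ∈ A →
      Tendsto (fun r => V d (Aᶜ ∩ Metric.closedBall p r) / V d (Metric.closedBall p r))
      (𝓝[>] 0) (𝓝 0) := by
  filter_upwards [Besicovitch.ae_tendsto_measure_inter_div_of_measurableSet (V d) hA.compl]
    with p hp hpA
  have hn : p ∉ Aᶜ := fun h => h hpA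
  rwa [Set.indicator_of_notMem hn] at hp

end HlamAux

theorem Hlam_tendsto_betaPrime_L1
    (d : ℕ) (hd : 1 ≤ d) (α k1 k2 ρ : ℝ) (hα : α ∈ Set.Ioo (0:ℝ) 1)
    (hk1 : 0 < k1) (hk2 : 0 < k2) (hρ : 0 < ρ)
    (kstar : ℝ) (hkstar : kstar = max k1 k2)
    (φ : EuclideanSpace ℝ (Fin d) → ℝ)
    (hφc : Continuous φ) (hφ0 : ∀ ξ, 0 ≤ φ ξ)
    (hφsupp : ∀ ξ, 1 < ‖ξ‖ → φ ξ = 0) (hφint : ∫ ξ, φ ξ = 1)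
    (hfun gfun : ℝ → ℝ → ℝ)
    (hyp : ∀ lam ∈ Set.Ioo (0:ℝ) 1, lam ^ α ≤ min k1 k2 →
      (∀ r, r < -(lam ^ α) → hfun lam r = k1) ∧
      (∀ r, ρ + lam ^ α < r → hfun lam r = k2) ∧
      (∀ r ∈ Set.Icc (-(lam ^ α)) (ρ + lam ^ α), hfun lam r = gfun lam r) ∧
      ContDiffOn ℝ 1 (gfun lam) (Set.Icc (-(lam ^ α)) (ρ + lam ^ α)) ∧
      gfun lam (-(lam ^ α)) = k1 ∧ gfun lam (ρ + lam ^ α) = k2 ∧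
      (∀ r ∈ Set.Icc (0:ℝ) ρ, gfun lam r = lam ^ α) ∧
      (∀ r ∈ Set.Icc (-(lam ^ α)) (ρ + lam ^ α),
        |derivWithin (gfun lam) (Set.Icc (-(lam ^ α)) (ρ + lam ^ α)) r| ≤
          kstar * lam ^ (-α)) ∧
      (∀ r ∈ Set.Icc (-(lam ^ α)) (ρ + lam ^ α),
        lam ^ α ≤ gfun lam r ∧ gfun lam r ≤ kstar))
    (y : ℝ × EuclideanSpace ℝ (Fin d) → ℝ) (hy : Measurable y)
    (Q : Set (ℝ × EuclideanSpace ℝ (Fin d))) (hQ : MeasurableSet Q)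
    (hQfin : volume Q < ⊤) :
    Tendsto (fun lam =>
        ∫ p in Q, |Hlam d lam φ (hfun lam) y p.1 p.2 - betaPrime k1 k2 ρ (y p)|)
      (nhdsWithin 0 (Set.Ioi 0)) (nhds 0) := by
  have hks : 0 < kstar := hkstar ▸ lt_max_of_lt_left hk1
  have hm1 : k1 ≤ kstar := hkstar ▸ le_max_left _ _
  have hm2 : k2 ≤ kstar := hkstar ▸ le_max_right _ _
  have := HlamAux.mu_prob φ hφ0 hφint
  obtain ⟨M, hM⟩ := HlamAux.mu_le φ hφc hφsupp
  have hpow : Tendsto (fun lam : ℝ => lam ^ α) (nhdsWithin 0 (Set.Ioi 0)) (nhds 0) := by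
    have h := (Real.continuousAt_rpow_const 0 α (Or.inr hα.1.le)).tendsto
    rw [Real.zero_rpow hα.1.ne'] at h
    exact h.mono_left nhdsWithin_le_nhds
  have hsmall : ∀ δ > 0, ∀ᶠ lam in nhdsWithin (0:ℝ) (Set.Ioi 0), lam ^ α < δ :=
    fun δ hδ => hpow.eventually (gt_mem_nhds hδ)
  have hev : ∀ᶠ lam in nhdsWithin (0:ℝ) (Set.Ioi 0), 0 < lam ∧ 0 < lam ^ α ∧
      Measurable (hfun lam) ∧ (∀ r, 0 ≤ hfun lam r ∧ hfun lam r ≤ kstar) ∧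
      (∀ r, r < -(lam ^ α) → hfun lam r = k1) ∧
      (∀ r, ρ + lam ^ α < r → hfun lam r = k2) ∧
      (∀ r ∈ Set.Icc (0:ℝ) ρ, hfun lam r = lam ^ α) := by
    filter_upwards [hsmall (min k1 k2) (lt_min hk1 hk2), Ioo_mem_nhdsGT (zero_lt_one (α := ℝ))]
      with lam hl1 hl2
    obtain ⟨h1, h2, h3, h4, -, -, h5, -, h6⟩ := hyp lam hl2 hl1.le
    have ha : 0 < lam ^ α := Real.rpow_pos_of_pos hl2.1 α
    obtain ⟨f1, f2⟩ := HlamAux.h_facts ha hk1 hk2 hρ hkstar _ _ h1 h2 h3 h4.continuousOn h6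
    refine ⟨hl2.1, ha, f1, f2, h1, h2, ?_⟩
    intro r hr
    rw [h3 r ⟨by linarith [hr.1], by linarith [hr.2]⟩, h5 r hr]
  have hbm : Measurable (betaPrime k1 k2 ρ) :=
    Measurable.ite measurableSet_Iio measurable_const
      (Measurable.ite measurableSet_Iic measurable_const measurable_const)
  have hbb : ∀ r, 0 ≤ betaPrime k1 k2 ρ r ∧ betaPrime k1 k2 ρ r ≤ kstar := by
    intro r
    unfold betaPrime
    split_ifs
    · exact ⟨hk1.le, hm1⟩
    · exact ⟨le_rfl, hks.le⟩
    · exact ⟨hk2.le, hm2⟩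
  have habs : ∀ u v : ℝ, (0 ≤ u ∧ u ≤ kstar) → (0 ≤ v ∧ v ≤ kstar) → |u - v| ≤ kstar := by
    intro u v hu hv
    rw [abs_le]; constructor <;> linarith [hu.1, hu.2, hv.1, hv.2]
  have hHeq : ∀ᶠ lam in nhdsWithin (0:ℝ) (Set.Ioi 0), ∀ p : ℝ × EuclideanSpace ℝ (Fin d),
      Hlam d lam φ (hfun lam) y p.1 p.2 = ∫ w, hfun lam (y (HlamAux.G lam p w)) ∂(HlamAux.mu φ) := by
    filter_upwards [hev] with lam ⟨hl, _, hmeas, hbd, _⟩ p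
    exact HlamAux.Hlam_eq φ hφc hφ0 hφint _ hmeas kstar
      (fun r => abs_le.2 ⟨by linarith [(hbd r).1], (hbd r).2⟩) y hy hl p
  -- pointwise a.e. convergence
  have hpt : ∀ᵐ p ∂(volume : Measure (ℝ × EuclideanSpace ℝ (Fin d))),
      Tendsto (fun lam => Hlam d lam φ (hfun lam) y p.1 p.2) (nhdsWithin 0 (Set.Ioi 0))
        (nhds (betaPrime k1 k2 ρ (y p))) := by
    have mA1 : ∀ n : ℕ, MeasurableSet {q | y q < -(1 / ((n:ℝ) + 1))} :=
      fun n => hy measurableSet_Iio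
    have mA2 : MeasurableSet {q | y q ∈ Set.Icc 0 ρ} := hy measurableSet_Icc
    have mA3 : ∀ n : ℕ, MeasurableSet {q | ρ + (1 / ((n:ℝ) + 1)) < y q} :=
      fun n => hy measurableSet_Ioi
    rw [Measure.volume_eq_prod]
    change ∀ᵐ p ∂(HlamAux.V d), _
    filter_upwards [ae_all_iff.2 fun n => HlamAux.density _ (mA1 n), HlamAux.density _ mA2,
      ae_all_iff.2 fun n => HlamAux.density _ (mA3 n)] with p hp1 hp2 hp3
    refine Tendsto.congr' (f₁ := fun lam => ∫ w, hfun lam (y (HlamAux.G lam p w)) ∂(HlamAux.mu φ)) ?_ ?_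
    · filter_upwards [hHeq] with lam h
      exact (h p).symm
    by_cases c1 : y p < 0
    · obtain ⟨n, hn⟩ := exists_nat_one_div_lt (neg_pos.2 c1)
      have hb : betaPrime k1 k2 ρ (y p) = k1 := by simp [betaPrime, c1]
      refine HlamAux.core φ hM _ (mA1 n) p (hp1 n (show y p < -(1 / ((n:ℝ) + 1)) by linarith))
        (fun lam q => hfun lam (y q)) _ kstar (fun lam => lam ^ α) hpow hks.le ?_
      filter_upwards [hev, hsmall (1 / ((n:ℝ) + 1)) (by positivity)]
        with lam ⟨hl, ha, hmeas, hbd, e1, e2, e3⟩ hs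
      refine ⟨hmeas.comp hy, ha.le, fun q => habs _ _ (hbd _) (hbb _), ?_⟩
      intro q hq
      replace hq : y q < -(1 / ((n:ℝ) + 1)) := hq
      rw [hb, e1 _ (by linarith)]
      simpa using ha.le
    by_cases c2 : y p ≤ ρ
    · have hb : betaPrime k1 k2 ρ (y p) = 0 := by simp [betaPrime, c1, c2]
      refine HlamAux.core φ hM _ mA2 p (hp2 ⟨not_lt.1 c1, c2⟩)
        (fun lam q => hfun lam (y q)) _ kstar (fun lam => lam ^ α) hpow hks.le ?_
      filter_upwards [hev] with lam ⟨hl, ha, hmeas, hbd, e1, e2, e3⟩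
      refine ⟨hmeas.comp hy, ha.le, fun q => habs _ _ (hbd _) (hbb _), ?_⟩
      intro q hq
      rw [hb, e3 _ hq, sub_zero, abs_of_pos ha]
    · obtain ⟨n, hn⟩ := exists_nat_one_div_lt (sub_pos.2 (not_le.1 c2))
      have hb : betaPrime k1 k2 ρ (y p) = k2 := by simp [betaPrime, c1, c2]
      refine HlamAux.core φ hM _ (mA3 n) p (hp3 n (show ρ + (1 / ((n:ℝ) + 1)) < y p by linarith))
        (fun lam q => hfun lam (y q)) _ kstar (fun lam => lam ^ α) hpow hks.le ?_
      filter_upwards [hev, hsmall (1 / ((n:ℝ) + 1)) (by positivity)]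
        with lam ⟨hl, ha, hmeas, hbd, e1, e2, e3⟩ hs
      refine ⟨hmeas.comp hy, ha.le, fun q => habs _ _ (hbd _) (hbb _), ?_⟩
      intro q hq
      replace hq : ρ + (1 / ((n:ℝ) + 1)) < y q := hq
      rw [hb, e2 _ (by linarith)]
      simpa using ha.le
  have hfinal := tendsto_integral_filter_of_dominated_convergence
    (μ := volume.restrict Q) (l := nhdsWithin (0:ℝ) (Set.Ioi 0))
    (F := fun lam p => |Hlam d lam φ (hfun lam) y p.1 p.2 - betaPrime k1 k2 ρ (y p)|)
    (f := fun _ => (0:ℝ)) (fun _ => kstar) ?_ ?_ ?_ ?_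
  · simpa using hfinal
  · filter_upwards [hHeq, hev] with lam h ⟨hl, ha, hmeas, hbd, e1, e2, e3⟩
    simp only [h]
    have hsm : StronglyMeasurable (fun p : ℝ × EuclideanSpace ℝ (Fin d) =>
        ∫ w, hfun lam (y (HlamAux.G lam p w)) ∂(HlamAux.mu φ)) := by
      apply StronglyMeasurable.integral_prod_right
      exact ((hmeas.comp hy).comp (HlamAux.G_meas lam)).stronglyMeasurable
    exact (hsm.measurable.sub (hbm.comp hy)).abs.aestronglyMeasurable
  · filter_upwards [hHeq, hev] with lam h ⟨hl, ha, hmeas, hbd, e1, e2, e3⟩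
    refine Eventually.of_forall fun p => ?_
    rw [Real.norm_eq_abs, abs_abs, h]
    refine habs _ _ ⟨integral_nonneg fun w => (hbd _).1, ?_⟩ (hbb _)
    have hb := norm_integral_le_of_norm_le_const (μ := HlamAux.mu φ) (C := kstar)
      (f := fun w => hfun lam (y (HlamAux.G lam p w)))
      (Eventually.of_forall fun w => abs_le.2 ⟨by linarith [(hbd (y (HlamAux.G lam p w))).1], (hbd _).2⟩)
    simp only [probReal_univ, mul_one] at hb
    exact (le_abs_self _).trans hb
  · have : IsFiniteMeasure (volume.restrict Q) := ⟨by simpa using hQfin⟩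
    exact integrable_const _
  · filter_upwards [ae_restrict_of_ae hpt] with p hp
    have := (hp.sub_const (betaPrime k1 k2 ρ (y p))).abs
    simpa using this
end

section
/- Let h : ℝ → ℝ be Lipschitz continuous with Lipschitz constant L ≥ 0, let y : ℝ × ℝ^d → ℝ be measurable, and fix (t,x). If there is K ≥ 0 such that |y(s,ξ) − y(t,x)| ≤ K(|s−t|^{1/2} + |ξ−x|^{1/2}) for all (s,ξ) ∈ [t, t+λ] × {ξ : |ξ−x| ≤ λ}, then |H_λ[h,y](t,x) − h(y(t,x))| ≤ 2 L K λ^{1/2}. -/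
open MeasureTheory Set

theorem Hlam_close_to_pointwise_value
    (d : ℕ) (hd : 1 ≤ d) (lam : ℝ) (hlam : lam ∈ Set.Ioo (0:ℝ) 1)
    (φ : EuclideanSpace ℝ (Fin d) → ℝ)
    (hφc : Continuous φ) (hφ0 : ∀ ξ, 0 ≤ φ ξ)
    (hφsupp : ∀ ξ, 1 < ‖ξ‖ → φ ξ = 0) (hφint : ∫ ξ, φ ξ = 1)
    (hfun : ℝ → ℝ) (L : ℝ) (hL : 0 ≤ L)
    (hLip : ∀ a b : ℝ, |hfun a - hfun b| ≤ L * |a - b|)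
    (y : ℝ × EuclideanSpace ℝ (Fin d) → ℝ) (hy : Measurable y)
    (t : ℝ) (x : EuclideanSpace ℝ (Fin d))
    (K : ℝ) (hK : 0 ≤ K)
    (hHolder : ∀ (s : ℝ) (ξ : EuclideanSpace ℝ (Fin d)),
      s ∈ Set.Icc t (t + lam) → ξ ∈ Metric.closedBall x lam →
      |y (s, ξ) - y (t, x)| ≤ K * (Real.sqrt |s - t| + Real.sqrt ‖ξ - x‖)) :
    |Hlam d lam φ hfun y t x - hfun (y (t, x))| ≤ 2 * L * K * Real.sqrt lam := by
  obtain ⟨h0, h1⟩ := hlam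
  set c := hfun (y (t, x)) with hc
  have hhc : Continuous hfun := by
    have : LipschitzWith ⟨L, hL⟩ hfun := LipschitzWith.of_dist_le_mul (fun a b => by
      rw [Real.dist_eq, Real.dist_eq]; exact hLip a b)
    exact this.continuous
  have hφi : Integrable φ := by
    by_contra hn
    rw [integral_undef hn] at hφint
    norm_num at hφint
  have hmeas : Measurable (fun p : ℝ × EuclideanSpace ℝ (Fin d) =>
      hfun (y (p.1, x - lam • p.2)) * φ p.2) := by
    have h2 : Measurable (fun p : ℝ × EuclideanSpace ℝ (Fin d) => (p.1, x - lam • p.2)) := by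
      fun_prop
    exact (hhc.measurable.comp (hy.comp h2)).mul (hφc.measurable.comp measurable_snd)
  have hpt : ∀ s ∈ Set.Icc t (t + lam), ∀ ξ,
      ‖hfun (y (s, x - lam • ξ)) * φ ξ - c * φ ξ‖ ≤ 2 * L * K * Real.sqrt lam * φ ξ := by
    intro s hs ξ
    by_cases hξ : 1 < ‖ξ‖
    · simp [hφsupp ξ hξ]
    push Not at hξ
    rw [← sub_mul, norm_mul, Real.norm_eq_abs, Real.norm_eq_abs, abs_of_nonneg (hφ0 ξ)]
    refine mul_le_mul_of_nonneg_right ?_ (hφ0 ξ)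
    have hn : ‖x - lam • ξ - x‖ ≤ lam := by
      have : x - lam • ξ - x = -(lam • ξ) := by abel
      rw [this, norm_neg, norm_smul, Real.norm_eq_abs, abs_of_pos h0]
      nlinarith
    have h3 := hHolder s (x - lam • ξ) hs (by rw [mem_closedBall_iff_norm]; exact hn)
    have h4 : Real.sqrt |s - t| ≤ Real.sqrt lam := by
      apply Real.sqrt_le_sqrt
      rw [abs_le]; constructor <;> linarith [hs.1, hs.2]
    have h5 := Real.sqrt_le_sqrt hn
    calc |hfun (y (s, x - lam • ξ)) - c| ≤ L * |y (s, x - lam • ξ) - y (t, x)| := hLip _ _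
      _ ≤ L * (K * (Real.sqrt lam + Real.sqrt lam)) := by
        refine mul_le_mul_of_nonneg_left (h3.trans ?_) hL
        exact mul_le_mul_of_nonneg_left (add_le_add h4 h5) hK
      _ = _ := by ring
  set F : ℝ → ℝ := fun s => ∫ ξ, hfun (y (s, x - lam • ξ)) * φ ξ with hF
  have hFm : StronglyMeasurable F := hmeas.stronglyMeasurable.integral_prod_right
  have hFb : ∀ s ∈ Set.Icc t (t + lam), ‖F s - c‖ ≤ 2 * L * K * Real.sqrt lam := by
    intro s hs
    have hd' : Integrable (fun ξ => hfun (y (s, x - lam • ξ)) * φ ξ - c * φ ξ) := by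
      refine (hφi.const_mul (2 * L * K * Real.sqrt lam)).mono' ?_
        (Filter.Eventually.of_forall (hpt s hs))
      exact ((hmeas.comp measurable_prodMk_left).sub
        (hφc.measurable.const_mul c)).aestronglyMeasurable
    have hi : Integrable (fun ξ => hfun (y (s, x - lam • ξ)) * φ ξ) := by
      refine (hd'.add (hφi.const_mul c)).congr (Filter.Eventually.of_forall fun ξ => ?_)
      simp only [Pi.add_apply, sub_add_cancel]
    have e : F s - c = ∫ ξ, (hfun (y (s, x - lam • ξ)) * φ ξ - c * φ ξ) := by
      rw [integral_sub hi (hφi.const_mul c), integral_const_mul, hφint, mul_one]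
    rw [e]
    refine (norm_integral_le_of_norm_le (hφi.const_mul (2 * L * K * Real.sqrt lam))
        (Filter.Eventually.of_forall (hpt s hs))).trans ?_
    rw [integral_const_mul, hφint, mul_one]
  have hle : t ≤ t + lam := by linarith
  have hIF : IntervalIntegrable F volume t (t + lam) := by
    have hI : IntervalIntegrable (fun s => F s - c) volume t (t + lam) := by
      refine (intervalIntegrable_const (c := 2 * L * K * Real.sqrt lam)).mono_fun'
        (hFm.sub stronglyMeasurable_const).aestronglyMeasurable ?_
      refine (ae_restrict_iff' measurableSet_uIoc).2 (Filter.Eventually.of_forall ?_)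
      intro s hs
      rw [uIoc_of_le hle] at hs
      exact hFb s ⟨hs.1.le, hs.2⟩
    simpa using hI.add (intervalIntegrable_const (c := c))
  have hb : ‖∫ s in t..(t + lam), (F s - c)‖ ≤ 2 * L * K * Real.sqrt lam * |t + lam - t| := by
    apply intervalIntegral.norm_integral_le_of_norm_le_const
    intro s hs
    rw [uIoc_of_le hle] at hs
    exact hFb s ⟨hs.1.le, hs.2⟩
  rw [intervalIntegral.integral_sub hIF intervalIntegrable_const,
    intervalIntegral.integral_const, add_sub_cancel_left, abs_of_pos h0, smul_eq_mul,
    Real.norm_eq_abs] at hb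
  have e2 : Hlam d lam φ hfun y t x - c
      = (1 / lam) * ((∫ s in t..(t + lam), F s) - lam * c) := by
    simp only [Hlam, hF]
    field_simp
  rw [e2, abs_mul, abs_of_pos (by positivity), one_div, inv_mul_le_iff₀ h0]
  linarith
end

section
/- Let y : ℝ × ℝ^d → ℝ be measurable, fix (t,x), and suppose there is K ≥ 0 such that |y(s,ξ) − y(t,x)| ≤ K(|s−t|^{1/2} + |ξ−x|^{1/2}) for all (s,ξ) ∈ [t, t+λ] × {ξ : |ξ−x| ≤ λ}. If y(t,x) ≤ −λ^α − 2Kλ^{1/2}, then H_λ[h_λ, y](t,x) = k1, i.e., at such a point of the solid region the averaged coefficient H_λ coincides with the solid heat conductivity k1. -/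
open MeasureTheory Set

theorem Hlam_eq_k1_in_solid_region
    (d : ℕ) (hd : 1 ≤ d) (lam α : ℝ)
    (hlam : lam ∈ Set.Ioo (0:ℝ) 1) (hα : α ∈ Set.Ioo (0:ℝ) 1)
    (φ : EuclideanSpace ℝ (Fin d) → ℝ)
    (hφc : Continuous φ) (hφ0 : ∀ ξ, 0 ≤ φ ξ)
    (hφsupp : ∀ ξ, 1 < ‖ξ‖ → φ ξ = 0) (hφint : ∫ ξ, φ ξ = 1)
    (k1 k2 ρ : ℝ) (hk1 : 0 < k1) (hk2 : 0 < k2) (hρ : 0 < ρ)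
    (kstar : ℝ) (hkstar : kstar = max k1 k2)
    (hsmall : lam ^ α ≤ min k1 k2)
    (hfun gfun : ℝ → ℝ)
    (hh1 : ∀ r, r < -(lam ^ α) → hfun r = k1)
    (hh2 : ∀ r, ρ + lam ^ α < r → hfun r = k2)
    (hh3 : ∀ r ∈ Set.Icc (-(lam ^ α)) (ρ + lam ^ α), hfun r = gfun r)
    (hgC1 : ContDiffOn ℝ 1 gfun (Set.Icc (-(lam ^ α)) (ρ + lam ^ α)))
    (hga : gfun (-(lam ^ α)) = k1) (hgb : gfun (ρ + lam ^ α) = k2)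
    (hgmid : ∀ r ∈ Set.Icc (0:ℝ) ρ, gfun r = lam ^ α)
    (hgderiv : ∀ r ∈ Set.Icc (-(lam ^ α)) (ρ + lam ^ α),
      |derivWithin gfun (Set.Icc (-(lam ^ α)) (ρ + lam ^ α)) r| ≤ kstar * lam ^ (-α))
    (hgbound : ∀ r ∈ Set.Icc (-(lam ^ α)) (ρ + lam ^ α),
      lam ^ α ≤ gfun r ∧ gfun r ≤ kstar)
    (y : ℝ × EuclideanSpace ℝ (Fin d) → ℝ) (hy : Measurable y)
    (t : ℝ) (x : EuclideanSpace ℝ (Fin d))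
    (K : ℝ) (hK : 0 ≤ K)
    (hHolder : ∀ (s : ℝ) (ξ : EuclideanSpace ℝ (Fin d)),
      s ∈ Set.Icc t (t + lam) → ξ ∈ Metric.closedBall x lam →
      |y (s, ξ) - y (t, x)| ≤ K * (Real.sqrt |s - t| + Real.sqrt ‖ξ - x‖))
    (hsolid : y (t, x) ≤ -(lam ^ α) - 2 * K * Real.sqrt lam) :
    Hlam d lam φ hfun y t x = k1 := by
  obtain ⟨hl0, hl1⟩ := hlam
  have hp : 0 < lam ^ α := Real.rpow_pos_of_pos hl0 α
  have hle : ∀ r, r ≤ -(lam ^ α) → hfun r = k1 := by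
    intro r hr
    rcases hr.lt_or_eq with h | h
    · exact hh1 r h
    · rw [h, hh3 _ ⟨le_refl _, by linarith⟩, hga]
  have key : ∀ s ∈ Set.Icc t (t + lam), ∀ ξ : EuclideanSpace ℝ (Fin d),
      hfun (y (s, x - lam • ξ)) * φ ξ = k1 * φ ξ := by
    intro s hs ξ
    by_cases hξ : 1 < ‖ξ‖
    · simp [hφsupp ξ hξ]
    · have hn : ‖(x - lam • ξ) - x‖ ≤ lam := by
        have h1 : (x - lam • ξ) - x = -(lam • ξ) := by abel
        rw [h1, norm_neg, norm_smul, Real.norm_of_nonneg hl0.le]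
        nlinarith [not_lt.mp hξ]
      have h2 := hHolder s (x - lam • ξ) hs (by rw [mem_closedBall_iff_norm]; exact hn)
      have h3 : Real.sqrt |s - t| ≤ Real.sqrt lam := by
        apply Real.sqrt_le_sqrt
        rw [abs_of_nonneg (by linarith [hs.1])]
        linarith [hs.2]
      have h4 := Real.sqrt_le_sqrt hn
      have h5 := mul_le_mul_of_nonneg_left (add_le_add h3 h4) hK
      rw [hle]
      have h6 := (abs_le.mp h2).2
      linarith
  unfold Hlam
  have hI : ∫ s in t..(t + lam), (∫ ξ, hfun (y (s, x - lam • ξ)) * φ ξ)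
      = ∫ s in t..(t + lam), k1 := by
    apply intervalIntegral.integral_congr
    intro s hs
    rw [Set.uIcc_of_le (by linarith)] at hs
    simp only [key s hs]
    rw [integral_const_mul, hφint, mul_one]
  rw [hI, intervalIntegral.integral_const, smul_eq_mul]
  field_simp
  ring
end

section
/- Let y : ℝ × ℝ^d → ℝ be measurable, fix (t,x), and suppose there is K ≥ 0 such that |y(s,ξ) − y(t,x)| ≤ K(|s−t|^{1/2} + |ξ−x|^{1/2}) for all (s,ξ) ∈ [t, t+λ] × {ξ : |ξ−x| ≤ λ}. If y(t,x) ≥ ρ + λ^α + 2Kλ^{1/2}, then H_λ[h_λ, y](t,x) = k2, i.e., at such a point of the liquid region the averaged coefficient H_λ coincides with the liquid heat conductivity k2. -/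
open MeasureTheory Set

theorem Hlam_eq_k2_in_liquid_region
    (d : ℕ) (hd : 1 ≤ d) (lam α : ℝ)
    (hlam : lam ∈ Set.Ioo (0:ℝ) 1) (hα : α ∈ Set.Ioo (0:ℝ) 1)
    (φ : EuclideanSpace ℝ (Fin d) → ℝ)
    (hφc : Continuous φ) (hφ0 : ∀ ξ, 0 ≤ φ ξ)
    (hφsupp : ∀ ξ, 1 < ‖ξ‖ → φ ξ = 0) (hφint : ∫ ξ, φ ξ = 1)
    (k1 k2 ρ : ℝ) (hk1 : 0 < k1) (hk2 : 0 < k2) (hρ : 0 < ρ)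
    (kstar : ℝ) (hkstar : kstar = max k1 k2)
    (hsmall : lam ^ α ≤ min k1 k2)
    (hfun gfun : ℝ → ℝ)
    (hh1 : ∀ r, r < -(lam ^ α) → hfun r = k1)
    (hh2 : ∀ r, ρ + lam ^ α < r → hfun r = k2)
    (hh3 : ∀ r ∈ Set.Icc (-(lam ^ α)) (ρ + lam ^ α), hfun r = gfun r)
    (hgC1 : ContDiffOn ℝ 1 gfun (Set.Icc (-(lam ^ α)) (ρ + lam ^ α)))
    (hga : gfun (-(lam ^ α)) = k1) (hgb : gfun (ρ + lam ^ α) = k2)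
    (hgmid : ∀ r ∈ Set.Icc (0:ℝ) ρ, gfun r = lam ^ α)
    (hgderiv : ∀ r ∈ Set.Icc (-(lam ^ α)) (ρ + lam ^ α),
      |derivWithin gfun (Set.Icc (-(lam ^ α)) (ρ + lam ^ α)) r| ≤ kstar * lam ^ (-α))
    (hgbound : ∀ r ∈ Set.Icc (-(lam ^ α)) (ρ + lam ^ α),
      lam ^ α ≤ gfun r ∧ gfun r ≤ kstar)
    (y : ℝ × EuclideanSpace ℝ (Fin d) → ℝ) (hy : Measurable y)
    (t : ℝ) (x : EuclideanSpace ℝ (Fin d))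
    (K : ℝ) (hK : 0 ≤ K)
    (hHolder : ∀ (s : ℝ) (ξ : EuclideanSpace ℝ (Fin d)),
      s ∈ Set.Icc t (t + lam) → ξ ∈ Metric.closedBall x lam →
      |y (s, ξ) - y (t, x)| ≤ K * (Real.sqrt |s - t| + Real.sqrt ‖ξ - x‖))
    (hliquid : ρ + lam ^ α + 2 * K * Real.sqrt lam ≤ y (t, x)) :
    Hlam d lam φ hfun y t x = k2 := by
  obtain ⟨hl0, hl1⟩ := hlam
  have hp : 0 < lam ^ α := Real.rpow_pos_of_pos hl0 α
  have hge : ∀ r, ρ + lam ^ α ≤ r → hfun r = k2 := by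
    intro r hr
    rcases hr.eq_or_lt with h | h
    · rw [← h, hh3 _ ⟨by linarith, le_rfl⟩, hgb]
    · exact hh2 r h
  have hin : ∀ s ∈ Set.Icc t (t + lam),
      (∫ ξ, hfun (y (s, x - lam • ξ)) * φ ξ) = k2 := by
    intro s hs
    have heq : ∀ ξ, hfun (y (s, x - lam • ξ)) * φ ξ = k2 * φ ξ := by
      intro ξ
      by_cases h1 : 1 < ‖ξ‖
      · simp [hφsupp ξ h1]
      · have hn : ‖(x - lam • ξ) - x‖ ≤ lam := by
          rw [sub_sub_cancel_left, norm_neg, norm_smul, Real.norm_of_nonneg hl0.le]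
          nlinarith [not_lt.mp h1]
        have hH := hHolder s (x - lam • ξ) hs (by
          rw [Metric.mem_closedBall, dist_eq_norm]; exact hn)
        have ha : Real.sqrt |s - t| ≤ Real.sqrt lam := by
          apply Real.sqrt_le_sqrt
          rw [abs_of_nonneg (by linarith [hs.1])]
          linarith [hs.2]
        have hb := Real.sqrt_le_sqrt hn
        have hc := mul_le_mul_of_nonneg_left (add_le_add ha hb) hK
        have he := (abs_le.mp hH).1
        rw [hge]
        linarith
    simp_rw [heq]
    rw [integral_const_mul, hφint, mul_one]
  unfold Hlam
  have hcongr : (∫ s in t..(t + lam), (∫ ξ, hfun (y (s, x - lam • ξ)) * φ ξ))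
      = ∫ _s in t..(t + lam), k2 := by
    apply intervalIntegral.integral_congr
    intro s hs
    rw [Set.uIcc_of_le (by linarith)] at hs
    exact hin s hs
  rw [hcongr, intervalIntegral.integral_const, smul_eq_mul]
  field_simp
  ring
end

section
/- Let T > 0, a > 0, C ≥ 0, let f : [0,T] → [0,∞) be continuous and g : [0,T] → [0,∞) be Lebesgue integrable. If f(t) + 2a ∫_0^t g(s) ds ≤ C ∫_0^t (f(s) g(s))^{1/2} ds for all t ∈ [0,T], then f ≡ 0 on [0,T] and g = 0 almost everywhere on [0,T]. (This is the Gronwall-type absorption argument used to prove uniqueness of the weak solution of the regularized Stefan problem.) -/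
open MeasureTheory Set intervalIntegral

theorem gronwall_absorption
    (T a C : ℝ) (hT : 0 < T) (ha : 0 < a) (hC : 0 ≤ C)
    (f g : ℝ → ℝ)
    (hf_cont : ContinuousOn f (Set.Icc 0 T))
    (hf_nonneg : ∀ t ∈ Set.Icc (0:ℝ) T, 0 ≤ f t)
    (hg_int : IntegrableOn g (Set.Icc 0 T))
    (hg_nonneg : ∀ t ∈ Set.Icc (0:ℝ) T, 0 ≤ g t)
    (hineq : ∀ t ∈ Set.Icc (0:ℝ) T,
      f t + 2 * a * (∫ s in (0:ℝ)..t, g s) ≤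
        C * ∫ s in (0:ℝ)..t, Real.sqrt (f s * g s)) :
    (∀ t ∈ Set.Icc (0:ℝ) T, f t = 0) ∧
      (∀ᵐ s ∂(volume.restrict (Set.Icc (0:ℝ) T)), g s = 0) := by
  have hK : 0 ≤ C ^ 2 / (4 * a) := by positivity
  obtain ⟨K, hKd⟩ : ∃ K, K = C ^ 2 / (4 * a) := ⟨_, rfl⟩
  rw [← hKd] at hK
  have hKa : 4 * a * K = C ^ 2 := by rw [hKd]; field_simp
  have key : ∀ t ∈ Set.Icc (0:ℝ) T,
      f t + a * (∫ s in (0:ℝ)..t, g s) ≤ K * ∫ s in (0:ℝ)..t, f s := by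
    intro t ht
    have hsub : Set.Ioc (0:ℝ) t ⊆ Set.Icc 0 T := fun s hs => ⟨hs.1.le, hs.2.trans ht.2⟩
    have hgi : IntegrableOn g (Set.Ioc 0 t) := hg_int.mono_set hsub
    have hfi : IntegrableOn f (Set.Ioc 0 t) := (hf_cont.integrableOn_Icc).mono_set hsub
    have h1 := hineq t ht
    rw [integral_of_le ht.1, integral_of_le ht.1] at h1
    rw [integral_of_le ht.1, integral_of_le ht.1]
    have h2 : ∫ s in Set.Ioc 0 t, C * Real.sqrt (f s * g s) ≤
        ∫ s in Set.Ioc 0 t, (a * g s + K * f s) := by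
      apply integral_mono_of_nonneg
      · exact Filter.Eventually.of_forall fun s => by positivity
      · exact (hgi.const_mul a).add (hfi.const_mul K)
      · refine (ae_restrict_iff' measurableSet_Ioc).2 (Filter.Eventually.of_forall fun s hs => ?_)
        have hf0 := hf_nonneg s (hsub hs)
        have hg0 := hg_nonneg s (hsub hs)
        apply le_of_sq_le_sq _ (by positivity)
        rw [mul_pow, Real.sq_sqrt (by positivity), ← hKa]
        nlinarith [sq_nonneg (a * g s - K * f s)]
    rw [MeasureTheory.integral_const_mul,
      integral_add (hgi.const_mul a) (hfi.const_mul K), MeasureTheory.integral_const_mul,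
      MeasureTheory.integral_const_mul] at h2
    linarith
  have hgI : ∀ t ∈ Set.Icc (0:ℝ) T, 0 ≤ ∫ s in (0:ℝ)..t, g s := fun t ht =>
    intervalIntegral.integral_nonneg ht.1 fun s hs => hg_nonneg s ⟨hs.1, hs.2.trans ht.2⟩
  have hfI : ∀ t ∈ Set.Icc (0:ℝ) T, 0 ≤ ∫ s in (0:ℝ)..t, f s := fun t ht =>
    intervalIntegral.integral_nonneg ht.1 fun s hs => hf_nonneg s ⟨hs.1, hs.2.trans ht.2⟩
  have hF : ∀ t ∈ Set.Icc (0:ℝ) T, ∫ s in (0:ℝ)..t, f s = 0 := by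
    set e : ℝ → ℝ := Set.IccExtend hT.le ((Set.Icc 0 T).domRestrict f) with he
    have hec : Continuous e := (continuousOn_iff_continuous_domRestrict.1 hf_cont).Icc_extend'
    have hee : ∀ t ∈ Set.Icc (0:ℝ) T, e t = f t := fun t ht => by
      rw [he, Set.IccExtend_of_mem _ _ ht]; rfl
    have hint : ∀ t ∈ Set.Icc (0:ℝ) T, ∫ s in (0:ℝ)..t, e s = ∫ s in (0:ℝ)..t, f s := by
      intro t ht
      apply intervalIntegral.integral_congr
      intro s hs
      rw [Set.uIcc_of_le ht.1] at hs
      exact hee s ⟨hs.1, hs.2.trans ht.2⟩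
    have hd : ∀ t, HasDerivAt (fun t => ∫ s in (0:ℝ)..t, e s) (e t) t := fun t =>
      hec.integral_hasStrictDerivAt 0 t |>.hasDerivAt
    intro t ht
    have := norm_le_gronwallBound_of_norm_deriv_right_le (δ := 0) (K := K) (ε := 0)
      (f := fun t => ∫ s in (0:ℝ)..t, e s) (f' := e) (a := 0) (b := T)
      (fun t _ => (hd t).continuousAt.continuousWithinAt)
      (fun t _ => (hd t).hasDerivWithinAt) (by simp) (fun x hx => by
        have hx' : x ∈ Set.Icc (0:ℝ) T := ⟨hx.1, hx.2.le⟩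
        rw [hint x hx', hee x hx', Real.norm_of_nonneg (hf_nonneg x hx'),
          Real.norm_of_nonneg (hfI x hx')]
        have := key x hx'
        have := mul_nonneg ha.le (hgI x hx')
        linarith) t ht
    rw [gronwallBound_ε0_δ0] at this
    rw [← hint t ht]
    exact norm_le_zero_iff.1 this
  refine ⟨fun t ht => ?_, ?_⟩
  · have h1 := key t ht
    rw [hF t ht] at h1
    have := mul_nonneg ha.le (hgI t ht)
    exact le_antisymm (by linarith) (hf_nonneg t ht)
  · have hTm : T ∈ Set.Icc (0:ℝ) T := ⟨hT.le, le_rfl⟩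
    have h1 := key T hTm
    rw [hF T hTm] at h1
    have h2 := hgI T hTm
    have h3 := hf_nonneg T hTm
    have h4 : ∫ s in (0:ℝ)..T, g s = 0 := by
      refine le_antisymm ?_ h2
      by_contra! h
      have := mul_pos ha h
      linarith
    rw [integral_of_le hT.le, ← integral_Icc_eq_integral_Ioc] at h4
    exact (setIntegral_eq_zero_iff_of_nonneg_ae
      ((ae_restrict_iff' measurableSet_Icc).2 (Filter.Eventually.of_forall hg_nonneg)) hg_int).1 h4
end
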